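/- Let d ≥ 1, let h > 0, and let M ⊆ ℝ^d be a Lebesgue-measurable min-max closed set of finite Lebesgue measure. Define C : ℝ^d → ℝ by C(a) = ∫_M N_h(a − x) dx (Lebesgue integral over M). Then C is MTP₂, i.e. C(u)·C(v) ≤ C(u ∧ v)·C(u ∨ v) for all u, v ∈ ℝ^d. -/

import Mathlib

open MeasureTheory

/-- The scaled standard Gaussian kernel on ℝ^d with covariance h²·I:
`N_h(z) = (2πh²)^{-d/2} · exp(-‖z‖²/(2h²))`. -/
noncomputable def gaussKernel (d : ℕ) (h : ℝ) (z : Fin d → ℝ) : ℝ :=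
  (2 * Real.pi * h ^ 2) ^ (-(d : ℝ) / 2) * Real.exp (-(∑ i, (z i) ^ 2) / (2 * h ^ 2))

open scoped ENNReal

theorem ENNReal.add_le_add_of_mul_le_mul {a b c d : ℝ≥0∞} (ha : a ≤ c) (hb : b ≤ c)
    (hab : a * b ≤ c * d) : a + b ≤ c + d := by
  rcases eq_or_ne c ⊤ with rfl | hc
  · simp
  rcases eq_or_ne d ⊤ with rfl | hd
  · simp
  lift c to NNReal using hc
  lift d to NNReal using hd
  lift a to NNReal using ne_top_of_le_ne_top ENNReal.coe_ne_top ha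
  lift b to NNReal using ne_top_of_le_ne_top ENNReal.coe_ne_top hb
  norm_cast at *
  rw [← NNReal.coe_le_coe] at *
  push_cast at *
  have hb0 := b.coe_nonneg
  have hd0 := d.coe_nonneg
  rcases c.coe_nonneg.eq_or_lt with h0 | h0
  · linarith
  · refine le_of_mul_le_mul_left ?_ h0
    nlinarith [mul_nonneg (sub_nonneg.2 ha) (sub_nonneg.2 hb)]

/-- The **four functions theorem** for integrals over a linear order. -/
theorem lintegral_mul_lintegral_le_of_linearOrder {α : Type*} [LinearOrder α] [MeasurableSpace α]
    (μ : Measure α) [SFinite μ] {f₁ f₂ f₃ f₄ : α → ℝ≥0∞} (h₁ : Measurable f₁)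
    (h₂ : Measurable f₂) (h₃ : Measurable f₃) (h₄ : Measurable f₄)
    (h : ∀ x y, f₁ x * f₂ y ≤ f₃ (x ⊓ y) * f₄ (x ⊔ y)) :
    (∫⁻ x, f₁ x ∂μ) * ∫⁻ x, f₂ x ∂μ ≤ (∫⁻ x, f₃ x ∂μ) * ∫⁻ x, f₄ x ∂μ := by
  have symmetrize {f g : α → ℝ≥0∞} (hf : Measurable f) (hg : Measurable g) :
      2 * ((∫⁻ x, f x ∂μ) * ∫⁻ x, g x ∂μ) =
        ∫⁻ p : α × α, (f p.1 * g p.2 + g p.1 * f p.2) ∂(μ.prod μ) := by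
    rw [lintegral_add_left (by fun_prop), lintegral_prod_mul hf.aemeasurable hg.aemeasurable,
      lintegral_prod_mul hg.aemeasurable hf.aemeasurable, two_mul,
      mul_comm (∫⁻ x, g x ∂μ)]
  have ordered (x y : α) (hxy : x ≤ y) :
      f₁ x * f₂ y + f₂ x * f₁ y ≤ f₃ x * f₄ y + f₄ x * f₃ y := by
    have hxx := h x x
    have hyy := h y y
    have h_xy := h x y
    have h_yx := h y x
    simp only [inf_idem, sup_idem, inf_eq_left.2 hxy, sup_eq_right.2 hxy, inf_eq_right.2 hxy,
      sup_eq_left.2 hxy] at hxx hyy h_xy h_yx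
    refine ENNReal.add_le_add_of_mul_le_mul h_xy (by rwa [mul_comm]) ?_
    calc f₁ x * f₂ y * (f₂ x * f₁ y) = (f₁ x * f₂ x) * (f₁ y * f₂ y) := by ring
      _ ≤ (f₃ x * f₄ x) * (f₃ y * f₄ y) := by gcongr
      _ = f₃ x * f₄ y * (f₄ x * f₃ y) := by ring
  rw [← ENNReal.mul_le_mul_iff_right two_ne_zero ENNReal.ofNat_ne_top, symmetrize h₁ h₂,
    symmetrize h₃ h₄]
  refine lintegral_mono fun ⟨x, y⟩ ↦ ?_
  rcases le_total x y with hxy | hxy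
  · exact ordered x y hxy
  · have := ordered y x hxy
    rw [add_comm (f₁ y * f₂ x), add_comm (f₃ y * f₄ x), mul_comm (f₁ y), mul_comm (f₂ y),
      mul_comm (f₃ y), mul_comm (f₄ y)] at this
    exact this

/-- The **four functions theorem** for integrals over `Fin n → ℝ`. -/
theorem lintegral_mul_lintegral_le_of_pi {n : ℕ} {f₁ f₂ f₃ f₄ : (Fin n → ℝ) → ℝ≥0∞}
    (h₁ : Measurable f₁) (h₂ : Measurable f₂) (h₃ : Measurable f₃) (h₄ : Measurable f₄)
    (h : ∀ x y, f₁ x * f₂ y ≤ f₃ (x ⊓ y) * f₄ (x ⊔ y)) :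
    (∫⁻ x, f₁ x) * ∫⁻ x, f₂ x ≤ (∫⁻ x, f₃ x) * ∫⁻ x, f₄ x := by
  induction n with
  | zero =>
    simp only [volume_pi, Measure.pi_of_empty _ (0 : Fin 0 → ℝ), lintegral_dirac]
    simpa using h 0 0
  | succ n ih =>
    let e := (MeasurableEquiv.piFinSuccAbove (fun _ : Fin (n + 1) ↦ ℝ) 0).symm
    have he (p : ℝ × (Fin n → ℝ)) : e p = Fin.cons p.1 p.2 := by
      simp [e, MeasurableEquiv.piFinSuccAbove]
      rfl
    have fubini {f : (Fin (n + 1) → ℝ) → ℝ≥0∞} (hf : Measurable f) :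
        ∫⁻ x, f x = ∫⁻ y : Fin n → ℝ, ∫⁻ t : ℝ, f (e (t, y)) := by
      rw [← ((volume_preserving_piFinSuccAbove (fun _ : Fin (n + 1) ↦ ℝ) 0).symm).lintegral_comp hf]
      exact lintegral_prod_symm' (fun p ↦ f (e p)) (hf.comp e.measurable)
    have marginal {f : (Fin (n + 1) → ℝ) → ℝ≥0∞} (hf : Measurable f) :
        Measurable fun y : Fin n → ℝ ↦ ∫⁻ t : ℝ, f (e (t, y)) :=
      (hf.comp e.measurable).lintegral_prod_left' (f := fun p ↦ f (e p))
    have slice {f : (Fin (n + 1) → ℝ) → ℝ≥0∞} (hf : Measurable f) (y : Fin n → ℝ) :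
        Measurable fun t : ℝ ↦ f (e (t, y)) :=
      (hf.comp e.measurable).comp measurable_prodMk_right
    rw [fubini h₁, fubini h₂, fubini h₃, fubini h₄]
    refine ih (marginal h₁) (marginal h₂) (marginal h₃) (marginal h₄) fun x y ↦ ?_
    refine lintegral_mul_lintegral_le_of_linearOrder volume (slice h₁ _) (slice h₂ _) (slice h₃ _)
      (slice h₄ _) fun s t ↦ (h _ _).trans_eq ?_
    congr 2 <;> ext i <;> refine Fin.cases ?_ (fun j ↦ ?_) i <;> simp [he]

theorem sq_inf_sub_inf_add_sq_sup_sub_sup_le (u v x y : ℝ) :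
    (u ⊓ v - x ⊓ y) ^ 2 + (u ⊔ v - x ⊔ y) ^ 2 ≤ (u - x) ^ 2 + (v - y) ^ 2 := by
  rcases le_total u v with huv | huv <;> rcases le_total x y with hxy | hxy <;>
    simp only [huv, hxy, inf_of_le_left, inf_of_le_right, sup_of_le_left, sup_of_le_right] <;>
    nlinarith [mul_nonneg (sub_nonneg.2 huv) (sub_nonneg.2 hxy)]

theorem gaussKernel_nonneg (d : ℕ) (h : ℝ) (z : Fin d → ℝ) : 0 ≤ gaussKernel d h z := by
  unfold gaussKernel
  positivity

theorem measurable_gaussKernel (d : ℕ) (h : ℝ) : Measurable (gaussKernel d h) := by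
  unfold gaussKernel
  fun_prop

theorem gaussKernel_le (d : ℕ) (h : ℝ) (z : Fin d → ℝ) :
    gaussKernel d h z ≤ (2 * Real.pi * h ^ 2) ^ (-(d : ℝ) / 2) := by
  unfold gaussKernel
  refine mul_le_of_le_one_right (by positivity) (Real.exp_le_one_iff.2 ?_)
  rw [neg_div]
  exact neg_nonpos.2 (div_nonneg (Finset.sum_nonneg fun i _ ↦ sq_nonneg _) (by positivity))

theorem gaussKernel_sub_mul_gaussKernel_sub_le (d : ℕ) (h : ℝ) (u v x y : Fin d → ℝ) :
    gaussKernel d h (u - x) * gaussKernel d h (v - y) ≤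
      gaussKernel d h (u ⊓ v - x ⊓ y) * gaussKernel d h (u ⊔ v - x ⊔ y) := by
  unfold gaussKernel
  rw [mul_mul_mul_comm, mul_mul_mul_comm _ (Real.exp _) _ (Real.exp _), ← Real.exp_add,
    ← Real.exp_add, ← add_div, ← add_div, ← neg_add, ← neg_add, ← Finset.sum_add_distrib,
    ← Finset.sum_add_distrib]
  gcongr _ * Real.exp (-?_ / _)
  exact Finset.sum_le_sum fun i _ ↦ sq_inf_sub_inf_add_sq_sup_sub_sup_le (u i) (v i) (x i) (y i)

theorem conv_uniform_minMaxClosed_is_MTP2 (d : ℕ) (hd : 1 ≤ d) (h : ℝ) (hh : 0 < h)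
    (M : Set (Fin d → ℝ)) (hMmeas : MeasurableSet M) (hMfin : volume M < ⊤)
    (hMclosed : ∀ a ∈ M, ∀ b ∈ M, a ⊓ b ∈ M ∧ a ⊔ b ∈ M)
    (C : (Fin d → ℝ) → ℝ)
    (hC : ∀ a, C a = ∫ x in M, gaussKernel d h (a - x)) :
    ∀ u v : Fin d → ℝ, C u * C v ≤ C (u ⊓ v) * C (u ⊔ v) := by
  intro u v
  let f (a : Fin d → ℝ) : (Fin d → ℝ) → ℝ≥0∞ :=
    M.indicator fun x ↦ ENNReal.ofReal (gaussKernel d h (a - x))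
  have hmeas (a : Fin d → ℝ) : Measurable fun x ↦ gaussKernel d h (a - x) :=
    (measurable_gaussKernel d h).comp (measurable_const.sub measurable_id)
  have hf (a : Fin d → ℝ) : Measurable (f a) := (hmeas a).ennreal_ofReal.indicator hMmeas
  have hC_nonneg (a : Fin d → ℝ) : 0 ≤ C a := by
    rw [hC]
    exact integral_nonneg fun x ↦ gaussKernel_nonneg d h _
  have hC_lintegral (a : Fin d → ℝ) : ENNReal.ofReal (C a) = ∫⁻ x, f a x := by
    rw [hC, lintegral_indicator hMmeas]
    refine ofReal_integral_eq_lintegral_ofReal ?_ (ae_of_all _ fun x ↦ gaussKernel_nonneg d h _)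
    refine Measure.integrableOn_of_bounded (M := (2 * Real.pi * h ^ 2) ^ (-(d : ℝ) / 2)) hMfin.ne
      (hmeas a).aestronglyMeasurable (ae_of_all _ fun x ↦ ?_)
    rw [Real.norm_of_nonneg (gaussKernel_nonneg d h _)]
    exact gaussKernel_le d h _
  rw [← ENNReal.ofReal_le_ofReal_iff (mul_nonneg (hC_nonneg _) (hC_nonneg _)),
    ENNReal.ofReal_mul (hC_nonneg _), ENNReal.ofReal_mul (hC_nonneg _)]
  simp only [hC_lintegral]
  refine lintegral_mul_lintegral_le_of_pi (hf _) (hf _) (hf _) (hf _) fun x y ↦ ?_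
  by_cases hx : x ∈ M
  · by_cases hy : y ∈ M
    · obtain ⟨hinf, hsup⟩ := hMclosed x hx y hy
      simp only [f, Set.indicator_of_mem, hx, hy, hinf, hsup]
      rw [← ENNReal.ofReal_mul (gaussKernel_nonneg d h _),
        ← ENNReal.ofReal_mul (gaussKernel_nonneg d h _)]
      exact ENNReal.ofReal_le_ofReal (gaussKernel_sub_mul_gaussKernel_sub_le d h u v x y)
    · simp [f, hy]
  · simp [f, hx]
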